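/- Let M denote the abelian group (ℤ/2ℤ) × ℤ and let F denote the abelian group of finitely supported functions ℤ → M (in Lean, `Finsupp ℤ (ZMod 2 × ℤ)`), writing `single n a` for the function sending n to a and every other integer to 0. Let N₁ ≤ F be the subgroup generated by all elements `single 0 a` (for a ∈ M) together with all elements of the form `single n a - single (-n) a` (for n ∈ ℤ and a ∈ M). Then the quotient group F / N₁ is not finitely generated as an abelian group. -/

import Mathlib

open Finsupp

/-- The homomorphism folding `x ^ n` and `x ^ (-n)` together, discarding the constant coefficient
and the `ZMod 2` component. The exponent `± (k + 1)` is sent to the index `k`. -/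
noncomputable def foldExponents : (ℤ →₀ ZMod 2 × ℤ) →+ (ℕ →₀ ℤ) :=
  Finsupp.liftAddHom fun n : ℤ =>
    if n = 0 then 0 else (Finsupp.singleAddHom (n.natAbs - 1)).comp (AddMonoidHom.snd _ _)

theorem foldExponents_single (n : ℤ) (a : ZMod 2 × ℤ) :
    foldExponents (Finsupp.single n a) =
      if n = 0 then 0 else Finsupp.single (n.natAbs - 1) a.2 := by
  rw [foldExponents, Finsupp.liftAddHom_apply_single]
  split_ifs <;> simp

theorem foldExponents_single_neg (n : ℤ) (a : ZMod 2 × ℤ) :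
    foldExponents (Finsupp.single (-n) a) = foldExponents (Finsupp.single n a) := by
  simp [foldExponents_single]

theorem foldExponents_surjective : Function.Surjective foldExponents := by
  intro g
  induction g using Finsupp.induction_linear with
  | zero => exact ⟨0, map_zero _⟩
  | add g h hg hh =>
    obtain ⟨x, rfl⟩ := hg
    obtain ⟨y, rfl⟩ := hh
    exact ⟨x + y, map_add _ _ _⟩
  | single k b =>
    refine ⟨Finsupp.single ((k : ℤ) + 1) (0, b), ?_⟩
    rw [foldExponents_single, if_neg (by lia), show ((k : ℤ) + 1).natAbs - 1 = k by lia]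

/-- the quotient `(ℤ₂ × ℤ)[x, x⁻¹] / ⟨1, xⁿ − x⁻ⁿ⟩` is not
finitely generated as an abelian group. -/
theorem stmt4 :
    let M := ZMod 2 × ℤ
    let F := ℤ →₀ M
    let N₁ : AddSubgroup F := AddSubgroup.closure
      ({x | ∃ a : M, x = Finsupp.single (0 : ℤ) a} ∪
        {x | ∃ n : ℤ, ∃ a : M,
          x = Finsupp.single n a - Finsupp.single (-n) a})
    ¬ AddGroup.FG (F ⧸ N₁) := by
  intro M F N₁ hFG
  have hker : N₁ ≤ foldExponents.ker := by
    refine (AddSubgroup.closure_le _).2 ?_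
    rintro _ (⟨a, rfl⟩ | ⟨n, a, rfl⟩)
    · exact foldExponents_single 0 a
    · exact (map_sub foldExponents _ _).trans (sub_eq_zero.2 (foldExponents_single_neg n a).symm)
  have hsurj : Function.Surjective (QuotientAddGroup.lift N₁ foldExponents hker) :=
    QuotientAddGroup.lift_surjective_of_surjective N₁ _ foldExponents_surjective hker
  have hfg : AddGroup.FG (ℕ →₀ ℤ) := AddGroup.fg_of_surjective hsurj
  have hfin : Module.Finite ℤ (ℕ →₀ ℤ) := Module.Finite.iff_addGroup_fg.2 hfg
  rcases Module.finite_finsupp_self_iff.1 hfin with h | h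
  · exact not_subsingleton ℤ h
  · exact not_finite ℕ
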